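/- log p(n) ~ π √(2n/3) as n → ∞; more precisely, (log p(n)) / √n converges to π √(2/3). -/

import Mathlib

open Real Filter

theorem eventually_exp_mul_le_quarter {F : ℝ → ℝ} {A β κ : ℝ} (hpos : ∀ t, 0 < t → 0 < F t)
    (hF : Tendsto (fun t => t * log (F t)) (nhdsWithin 0 (Set.Ioi 0)) (nhds A))
    (hβ : 0 < β) (h : A / β + κ < A) :
    ∀ᶠ t in nhdsWithin 0 (Set.Ioi 0), exp (κ / t) * F (β * t) ≤ F t / 4 := by
  have hscale : Tendsto (fun t : ℝ => β * t) (nhdsWithin 0 (Set.Ioi 0))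
      (nhdsWithin 0 (Set.Ioi 0)) := by
    refine tendsto_nhdsWithin_iff.2 ⟨?_, ?_⟩
    · have : Tendsto (fun t : ℝ => β * t) (nhds 0) (nhds (β * 0)) :=
        (continuous_const.mul continuous_id).tendsto 0
      rw [mul_zero] at this
      exact this.mono_left nhdsWithin_le_nhds
    · filter_upwards [self_mem_nhdsWithin] with t ht
      exact mul_pos hβ ht
  have hid : Tendsto (fun t : ℝ => t * log 4) (nhdsWithin 0 (Set.Ioi 0)) (nhds 0) := by
    have : Tendsto (fun t : ℝ => t * log 4) (nhds 0) (nhds (0 * log 4)) :=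
      (continuous_id.mul continuous_const).tendsto 0
    rw [zero_mul] at this
    exact this.mono_left nhdsWithin_le_nhds
  have hlim := (((hF.comp hscale).div_const β).add_const κ).add hid
  rw [add_zero] at hlim
  filter_upwards [hlim.eventually_lt hF h, self_mem_nhdsWithin] with t hlt ht
  have ht : 0 < t := ht
  have hFβ := hpos (β * t) (mul_pos hβ ht)
  have hFt := hpos t ht
  simp only [Function.comp_apply] at hlt
  have hlog : κ / t + log (F (β * t)) ≤ log (F t) - log 4 := by
    have e : β * t * log (F (β * t)) / β + κ + t * log 4
        = t * (κ / t + log (F (β * t)) + log 4) := by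
      field_simp
      ring
    rw [e] at hlt
    have := lt_of_mul_lt_mul_left hlt ht.le
    linarith
  rw [← log_le_log_iff (by positivity) (by positivity), log_mul (by positivity) hFβ.ne',
    log_exp, log_div hFt.ne' (by norm_num)]
  exact hlog

theorem laplace_le_tails_add {a : ℕ → ℝ} (hmono : Monotone a) (hnonneg : ∀ n, 0 ≤ a n)
    (hs : ∀ t : ℝ, 0 < t → Summable fun n : ℕ => a n * exp (-t * n))
    {r t s : ℝ} (hr : 0 < r) (hrt : r ≤ t) (hts : t ≤ s) (n : ℕ) (y : ℝ) :
    ∑' m : ℕ, a m * exp (-t * m) ≤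
      exp (-(t - r) * n) * ∑' m : ℕ, a m * exp (-r * m)
        + exp ((s - t) * y) * ∑' m : ℕ, a m * exp (-s * m)
        + (n + 1) * (a n * exp (-t * y)) := by
  have ht : 0 < t := hr.trans_le hrt
  have hR := (hs r hr).hasSum.mul_left (exp (-(t - r) * n))
  have hS := (hs s (ht.trans_le hts)).hasSum.mul_left (exp ((s - t) * y))
  have hfin : HasSum (fun m : ℕ => if m ∈ Finset.range (n + 1) then a n * exp (-t * y) else 0)
      ((n + 1) * (a n * exp (-t * y))) := by
    have := hasSum_sum_of_ne_finset_zero (L := .unconditional ℕ) (s := Finset.range (n + 1))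
      (f := fun m : ℕ => if m ∈ Finset.range (n + 1) then a n * exp (-t * y) else 0)
      (fun m hm => if_neg hm)
    convert this using 1
    rw [Finset.sum_congr rfl (fun m hm => if_pos hm)]
    simp
  refine hasSum_le (fun m => ?_) (hs t ht).hasSum ((hR.add hS).add hfin)
  have h1 : 0 ≤ exp (-(t - r) * n) * (a m * exp (-r * m)) :=
    mul_nonneg (exp_nonneg _) (mul_nonneg (hnonneg m) (exp_nonneg _))
  have h2 : 0 ≤ exp ((s - t) * y) * (a m * exp (-s * m)) :=
    mul_nonneg (exp_nonneg _) (mul_nonneg (hnonneg m) (exp_nonneg _))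
  have h3 : 0 ≤ if m ∈ Finset.range (n + 1) then a n * exp (-t * y) else 0 := by
    split_ifs
    · exact mul_nonneg (hnonneg n) (exp_nonneg _)
    · exact le_rfl
  by_cases hmn : m ≤ n
  · by_cases hmy : (m : ℝ) ≤ y
    · have : a m * exp (-t * m) ≤ exp ((s - t) * y) * (a m * exp (-s * m)) := by
        rw [mul_left_comm, ← exp_add]
        refine mul_le_mul_of_nonneg_left (exp_le_exp.2 ?_) (hnonneg m)
        nlinarith
      linarith
    · have : a m * exp (-t * m) ≤ a n * exp (-t * y) :=
        mul_le_mul (hmono hmn) (exp_le_exp.2 (by nlinarith)) (exp_nonneg _) (hnonneg n)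
      rw [if_pos (Finset.mem_range.2 (by omega))] at h3 ⊢
      linarith
  · have : a m * exp (-t * m) ≤ exp (-(t - r) * n) * (a m * exp (-r * m)) := by
      have hnm : (n : ℝ) ≤ m := by exact_mod_cast (not_le.1 hmn).le
      rw [mul_left_comm, ← exp_add]
      refine mul_le_mul_of_nonneg_left (exp_le_exp.2 ?_) (hnonneg m)
      nlinarith
    linarith

theorem tendsto_sqrt_div_natCast {B : ℝ} (hB : 0 < B) :
    Tendsto (fun n : ℕ => √(B / n)) atTop (nhdsWithin 0 (Set.Ioi 0)) := by
  refine tendsto_nhdsWithin_iff.2 ⟨?_, ?_⟩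
  · simpa using (tendsto_const_div_atTop_nhds_zero_nat B).sqrt
  · filter_upwards [eventually_gt_atTop 0] with n hn
    exact sqrt_pos.2 (by positivity)

theorem tendsto_sqrt_div_mul_log {B : ℝ} :
    Tendsto (fun n : ℕ => √(B / n) * log (n + 1)) atTop (nhds 0) := by
  have h := ((isLittleO_log_rpow_atTop (r := 1 / 2) (by norm_num)).tendsto_div_nhds_zero).comp
    (tendsto_natCast_atTop_atTop (R := ℝ))
  have h2 : Tendsto (fun n : ℕ => √(B / n) * log 2) atTop (nhds 0) := by
    simpa using ((tendsto_const_div_atTop_nhds_zero_nat B).sqrt).mul_const (log 2)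
  have h3 := (h.const_mul √B).add h2
  rw [mul_zero, add_zero] at h3
  refine squeeze_zero' (Eventually.of_forall fun n => ?_) ?_ h3
  · exact mul_nonneg (sqrt_nonneg _) (log_nonneg (by simp))
  · filter_upwards [eventually_ge_atTop 1] with n hn
    have hn' : (1 : ℝ) ≤ n := by exact_mod_cast hn
    have hle : log (n + 1) ≤ log n + log 2 := by
      rw [← log_mul (by positivity) (by norm_num)]
      exact log_le_log (by positivity) (by linarith)
    have e : √(B / n) * log n = √B * (log n / (n : ℝ) ^ (1 / 2 : ℝ)) := by
      rw [sqrt_div' _ (by positivity), ← sqrt_eq_rpow]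
      ring
    simp only [Function.comp_apply]
    rw [← e, ← mul_add]
    exact mul_le_mul_of_nonneg_left hle (sqrt_nonneg _)

theorem tendsto_log_div_sqrt_of_laplace {a : ℕ → ℝ} {A : ℝ} (hA : 0 < A) (hmono : Monotone a)
    (hpos : ∀ n, 0 < a n)
    (hs : ∀ t : ℝ, 0 < t → Summable fun n : ℕ => a n * exp (-t * n))
    (hF : Tendsto (fun t => t * log (∑' n : ℕ, a n * exp (-t * n)))
      (nhdsWithin 0 (Set.Ioi 0)) (nhds A)) :
    Tendsto (fun n : ℕ => log (a n) / √n) atTop (nhds (2 * √A)) := by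
  set F : ℝ → ℝ := fun t => ∑' n : ℕ, a n * exp (-t * n) with hFdef
  have hterm : ∀ t : ℝ, 0 < t → ∀ n : ℕ, a n * exp (-t * n) ≤ F t := fun t ht n =>
    (hs t ht).le_tsum n fun m _ => mul_nonneg (hpos m).le (exp_nonneg _)
  have hFpos : ∀ t, 0 < t → 0 < F t := fun t ht =>
    (mul_pos (hpos 0) (exp_pos _)).trans_le (hterm t ht 0)
  refine tendsto_order.2 ⟨fun b hb => ?_, fun b hb => ?_⟩
  · have hcont : Tendsto (fun δ : ℝ => A * (2 - δ) / √(A * (1 + δ)))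
        (nhdsWithin 0 (Set.Ioi 0)) (nhds (2 * √A)) := by
      have : ContinuousAt (fun δ : ℝ => A * (2 - δ) / √(A * (1 + δ))) 0 := by
        refine ContinuousAt.div (by fun_prop) (by fun_prop) ?_
        simpa using (sqrt_pos.2 hA).ne'
      have h0 : A * (2 - 0) / √(A * (1 + 0)) = 2 * √A := by
        have := sqrt_pos.2 hA
        have h2 := mul_self_sqrt hA.le
        rw [add_zero, mul_one, sub_zero, div_eq_iff this.ne']
        linarith
      rw [← h0]
      exact this.tendsto.mono_left nhdsWithin_le_nhds
    obtain ⟨δ, hδb, hδ1, hδ0⟩ := ((hcont.eventually_const_lt hb).and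
      ((eventually_nhdsWithin_of_eventually_nhds (eventually_lt_nhds (zero_lt_one' ℝ))).and
        self_mem_nhdsWithin)).exists
    have hδ0 : 0 < δ := hδ0
    set B := A * (1 + δ) with hB
    have hBpos : 0 < B := by positivity
    have ht := tendsto_sqrt_div_natCast hBpos
    have htail1 := ht.eventually (eventually_exp_mul_le_quarter hFpos hF
      (β := 1 - δ / 2) (κ := -(δ / 2 * B)) (by linarith) (by
        rw [hB, div_add' _ _ _ (by linarith), div_lt_iff₀ (by linarith)]
        nlinarith [mul_pos hA (mul_pos hδ0 (mul_pos hδ0 (sub_pos.2 hδ1))),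
          mul_pos hA (mul_pos hδ0 hδ0)]))
    have htail2 := ht.eventually (eventually_exp_mul_le_quarter hFpos hF
      (β := 1 + δ / 2) (κ := δ / 2 * (A * (1 - δ))) (by linarith) (by
        rw [div_add' _ _ _ (by linarith), div_lt_iff₀ (by linarith)]
        nlinarith [mul_pos hA (mul_pos hδ0 (mul_pos hδ0 hδ0)),
          mul_pos hA (mul_pos hδ0 hδ0)]))
    have hlim : Tendsto (fun n : ℕ => (√(B / n) * log (F √(B / n)) + A * (1 - δ)
        - √(B / n) * log 2 - √(B / n) * log (n + 1)) / √B) atTop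
        (nhds (A * (2 - δ) / √B)) := by
      have h2 : Tendsto (fun n : ℕ => √(B / n) * log 2) atTop (nhds 0) := by
        simpa using (ht.mono_right nhdsWithin_le_nhds).mul_const (log 2)
      rw [show A * (2 - δ) = A + A * (1 - δ) - 0 - 0 by ring]
      exact (((((hF.comp ht).add_const (A * (1 - δ))).sub h2).sub
        (tendsto_sqrt_div_mul_log (B := B)))).div_const √B
    filter_upwards [htail1, htail2, hlim.eventually_const_lt hδb, eventually_gt_atTop 0]
      with n h1 h2 h3 hn
    refine h3.trans_le ?_
    have hn' : (0 : ℝ) < n := by exact_mod_cast hn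
    have htn : √(B / n) * √n = √B := by
      rw [sqrt_div' _ hn'.le]; field_simp
    set t := √(B / n) with htdef
    have htpos : 0 < t := sqrt_pos.2 (by positivity)
    have htt : t * n = B / t := by
      rw [eq_div_iff htpos.ne', mul_right_comm, htdef, mul_self_sqrt (by positivity)]
      field_simp
    have hmain := laplace_le_tails_add hmono (fun n => (hpos n).le) hs
      (r := (1 - δ / 2) * t) (t := t) (s := (1 + δ / 2) * t) (by nlinarith) (by nlinarith)
      (by nlinarith) n (A * (1 - δ) / t / t)
    have e1 : -(t - (1 - δ / 2) * t) * n = -(δ / 2 * B) / t := by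
      have : -(t - (1 - δ / 2) * t) * n = -(δ / 2) * (t * n) := by ring
      rw [this, htt]; ring
    have e2 : ((1 + δ / 2) * t - t) * (A * (1 - δ) / t / t) = δ / 2 * (A * (1 - δ)) / t := by
      field_simp; ring
    have e3 : -t * (A * (1 - δ) / t / t) = -(A * (1 - δ) / t) := by
      field_simp
    rw [e1, e2, e3] at hmain
    have hhalf : F t / 2 ≤ (n + 1) * (a n * exp (-(A * (1 - δ) / t))) := by
      simp only [hFdef] at h1 h2 ⊢
      linarith
    have hFt := hFpos t htpos
    have hlog := log_le_log (by positivity) hhalf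
    rw [log_div hFt.ne' (by norm_num), log_mul (by positivity)
      (mul_pos (hpos n) (exp_pos _)).ne', log_mul (hpos n).ne' (exp_ne_zero _), log_exp] at hlog
    rw [div_le_div_iff₀ (sqrt_pos.2 hBpos) (sqrt_pos.2 hn'), ← htn]
    have hmul := mul_le_mul_of_nonneg_left hlog htpos.le
    have e4 : t * (A * (1 - δ) / t) = A * (1 - δ) := by field_simp
    have : t * log (F t) + A * (1 - δ) - t * log 2 - t * log (n + 1) ≤ t * log (a n) := by
      nlinarith
    nlinarith [mul_le_mul_of_nonneg_right this (sqrt_nonneg (n : ℝ))]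
  · have ht := tendsto_sqrt_div_natCast hA
    have hlim := ((hF.comp ht).div_const √A).const_add √A
    have hA2 : √A + A / √A = 2 * √A := by
      rw [div_sqrt]; ring
    rw [hA2] at hlim
    filter_upwards [hlim.eventually_lt_const hb, eventually_gt_atTop 0] with n h3 hn
    refine lt_of_le_of_lt ?_ h3
    have hn' : (0 : ℝ) < n := by exact_mod_cast hn
    have htn : √(A / n) * √n = √A := by
      rw [sqrt_div' _ hn'.le]; field_simp
    simp only [Function.comp_apply]
    set t := √(A / n) with htdef
    have htpos : 0 < t := sqrt_pos.2 (by positivity)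
    have hlog := log_le_log (mul_pos (hpos n) (exp_pos _)) (hterm t htpos n)
    rw [log_mul (hpos n).ne' (exp_ne_zero _), log_exp] at hlog
    have hsn := sqrt_pos.2 hn'
    have e : t * log (F t) / √A = log (F t) / √n := by
      rw [← htn]; field_simp
    rw [e, div_le_iff₀ hsn, add_mul, div_mul_cancel₀ _ hsn.ne', ← htn, mul_assoc,
      mul_self_sqrt hn'.le]
    linarith

theorem hasSum_coeff_mul_mul_pow {f g : PowerSeries ℝ} {x a b : ℝ}
    (hf : HasSum (fun n => PowerSeries.coeff n f * x ^ n) a)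
    (hg : HasSum (fun n => PowerSeries.coeff n g * x ^ n) b) :
    HasSum (fun n => PowerSeries.coeff n (f * g) * x ^ n) (a * b) := by
  have e : (fun n => PowerSeries.coeff n (f * g) * x ^ n) = fun n =>
      ∑ kl ∈ Finset.HasAntidiagonal.antidiagonal n,
        (PowerSeries.coeff kl.1 f * x ^ kl.1) * (PowerSeries.coeff kl.2 g * x ^ kl.2) := by
    funext n
    rw [PowerSeries.coeff_mul, Finset.sum_mul]
    refine Finset.sum_congr rfl fun kl hkl => ?_
    rw [← Finset.HasAntidiagonal.mem_antidiagonal.1 hkl, pow_add]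
    ring
  rw [e, ← hf.tsum_eq, ← hg.tsum_eq,
    tsum_mul_tsum_eq_tsum_sum_antidiagonal_of_summable_norm hf.summable.norm hg.summable.norm]
  exact (summable_norm_sum_mul_antidiagonal_of_summable_norm
    hf.summable.norm hg.summable.norm).of_norm.hasSum

theorem hasSum_coeff_prod_mul_pow {ι : Type*} (s : Finset ι) {f : ι → PowerSeries ℝ} {x : ℝ}
    {a : ι → ℝ}
    (h : ∀ i ∈ s, HasSum (fun n => PowerSeries.coeff n (f i) * x ^ n) (a i)) :
    HasSum (fun n => PowerSeries.coeff n (∏ i ∈ s, f i) * x ^ n) (∏ i ∈ s, a i) := by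
  classical
  induction s using Finset.induction_on with
  | empty =>
    convert! hasSum_ite_eq (0 : ℕ) (1 : ℝ) using 2 with n
    by_cases hn : n = 0 <;> simp [PowerSeries.coeff_one, hn]
  | insert i s hi ih =>
    rw [Finset.prod_insert hi, Finset.prod_insert hi]
    exact hasSum_coeff_mul_mul_pow (h i (Finset.mem_insert_self i s))
      (ih fun j hj => h j (Finset.mem_insert_of_mem hj))

open scoped PowerSeries.WithPiTopology in
theorem coeff_tsum_X_pow_mul {d : ℕ} (hd : 0 < d) (n : ℕ) :
    PowerSeries.coeff n (∑' j : ℕ, (PowerSeries.X : PowerSeries ℝ) ^ (d * j)) =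
      if d ∣ n then 1 else 0 := by
  have h : HasSum (fun j : ℕ => (PowerSeries.X : PowerSeries ℝ) ^ (d * j))
      (PowerSeries.mk fun n => if d ∣ n then (1 : ℝ) else 0) := by
    rw [PowerSeries.WithPiTopology.hasSum_iff_hasSum_coeff]
    intro m
    simp only [PowerSeries.coeff_X_pow, PowerSeries.coeff_mk]
    split_ifs with hm
    · obtain ⟨k, rfl⟩ := hm
      convert! hasSum_ite_eq k (1 : ℝ) using 3 with j
      rw [Nat.mul_right_inj hd.ne', eq_comm]
    · convert! hasSum_zero with j
      rw [if_neg]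
      rintro rfl
      exact hm (dvd_mul_right d j)
  rw [h.tsum_eq, PowerSeries.coeff_mk]

theorem hasSum_ite_dvd_mul_pow {d : ℕ} (hd : 0 < d) {x : ℝ} (hx0 : 0 ≤ x) (hx1 : x < 1) :
    HasSum (fun n : ℕ => (if d ∣ n then (1 : ℝ) else 0) * x ^ n) (1 - x ^ d)⁻¹ := by
  have hgeom := hasSum_geometric_of_lt_one (pow_nonneg hx0 d) (pow_lt_one₀ hx0 hx1 hd.ne')
  have hinj : Function.Injective fun j : ℕ => d * j := fun i j hij =>
    Nat.eq_of_mul_eq_mul_left hd hij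
  rw [← hinj.hasSum_iff]
  · convert hgeom using 2 with j
    simp [pow_mul]
  · intro n hn
    rw [if_neg, zero_mul]
    rintro ⟨k, rfl⟩
    exact hn ⟨k, rfl⟩

open scoped PowerSeries.WithPiTopology in
theorem hasSum_card_restricted_le_mul_pow (N : ℕ) {x : ℝ} (hx0 : 0 ≤ x) (hx1 : x < 1) :
    HasSum (fun n : ℕ => ((Nat.Partition.restricted n (· ≤ N)).card : ℝ) * x ^ n)
      (∏ i ∈ Finset.range N, (1 - x ^ (i + 1))⁻¹) := by
  have hprod := hasProd_prod_of_ne_finset_one (L := .unconditional ℕ) (s := Finset.range N)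
    (f := fun i : ℕ => if i + 1 ≤ N then
      ∑' j : ℕ, (PowerSeries.X : PowerSeries ℝ) ^ ((i + 1) * j) else 1)
    (fun i hi => if_neg (by simpa using hi))
  have heq := (Nat.Partition.hasProd_powerSeriesMk_card_restricted ℝ (· ≤ N)).unique hprod
  have := hasSum_coeff_prod_mul_pow (Finset.range N) (x := x)
    (f := fun i : ℕ => if i + 1 ≤ N then
      ∑' j : ℕ, (PowerSeries.X : PowerSeries ℝ) ^ ((i + 1) * j) else 1)
    (a := fun i => (1 - x ^ (i + 1))⁻¹) (fun i hi => by
      rw [if_pos (by simpa using hi)]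
      simp only [coeff_tsum_X_pow_mul (Nat.succ_pos i)]
      exact hasSum_ite_dvd_mul_pow (Nat.succ_pos i) hx0 hx1)
  rw [← heq] at this
  simpa only [PowerSeries.coeff_mk] using this

theorem card_restricted_le_eq_card {n N : ℕ} (h : n ≤ N) :
    (Nat.Partition.restricted n (· ≤ N)).card = Fintype.card (Nat.Partition n) := by
  rw [Nat.Partition.restricted, Finset.filter_true_of_mem, Finset.card_univ]
  exact fun p _ i hi => (Nat.Partition.le_of_mem_parts hi).trans h

theorem monotone_card_partition : Monotone fun n : ℕ => Fintype.card (Nat.Partition n) := by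
  refine monotone_nat_of_le_succ fun n => ?_
  refine Fintype.card_le_of_injective (fun p : Nat.Partition n =>
    (⟨1 ::ₘ p.parts, ?_, ?_⟩ : Nat.Partition (n + 1))) ?_
  · intro i hi
    rcases Multiset.mem_cons.1 hi with rfl | hi
    · exact Nat.one_pos
    · exact p.parts_pos hi
  · rw [Multiset.sum_cons, p.parts_sum, add_comm]
  · intro p q hpq
    exact Nat.Partition.ext ((Multiset.cons_inj_right 1).1 (congrArg Nat.Partition.parts hpq))

theorem log_prod_inv_one_sub_pow_hasSum (N : ℕ) {x : ℝ} (hx0 : 0 < x) (hx1 : x < 1) :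
    HasSum (fun k : ℕ => (∑ i ∈ Finset.range N, (x ^ (k + 1)) ^ (i + 1)) / (k + 1))
      (log (∏ i ∈ Finset.range N, (1 - x ^ (i + 1))⁻¹)) := by
  have hlt : ∀ i : ℕ, x ^ (i + 1) < 1 := fun i => pow_lt_one₀ hx0.le hx1 i.succ_ne_zero
  rw [log_prod (fun i _ => (inv_pos.2 (sub_pos.2 (hlt i))).ne')]
  simp only [Finset.sum_div, log_inv]
  refine hasSum_sum fun i _ => ?_
  have := hasSum_pow_div_log_of_abs_lt_one (x := x ^ (i + 1))
    (by rw [abs_of_pos (by positivity)]; exact hlt i)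
  convert this using 3 with k
  rw [← pow_mul, ← pow_mul, mul_comm]

theorem hasSum_exp_neg_pow_succ {u : ℝ} (hu : 0 < u) :
    HasSum (fun i : ℕ => exp (-u) ^ (i + 1)) (exp u - 1)⁻¹ := by
  have h1 : exp (-u) < 1 := exp_lt_one_iff.2 (by linarith)
  have h := (hasSum_geometric_of_lt_one (exp_nonneg (-u)) h1).mul_left (exp (-u))
  have h2 : 1 < exp u := one_lt_exp_iff.2 hu
  convert! h using 1
  · funext i; rw [pow_succ']
  · rw [exp_neg] at h1 ⊢
    have : exp u - 1 ≠ 0 := by linarith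
    have h3 : 1 - (exp u)⁻¹ ≠ 0 := by linarith
    field_simp

theorem inv_exp_sub_one_le {u : ℝ} (hu : 0 < u) : (exp u - 1)⁻¹ ≤ u⁻¹ :=
  inv_anti₀ hu (by linarith [add_one_le_exp u])

theorem inv_sub_one_le_inv_exp_sub_one {u : ℝ} (hu : 0 < u) : u⁻¹ - 1 ≤ (exp u - 1)⁻¹ := by
  have h2 : 0 < exp u - 1 := sub_pos.2 (one_lt_exp_iff.2 hu)
  rw [← one_div (exp u - 1), le_div_iff₀ h2]
  have h3 : (1 - u) * exp u ≤ 1 := by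
    have := mul_le_mul_of_nonneg_right (one_sub_le_exp_neg u) (exp_nonneg u)
    rwa [← exp_add, neg_add_cancel, exp_zero] at this
  have e : (u⁻¹ - 1) * (exp u - 1) = ((1 - u) * exp u - (1 - u)) / u := by
    field_simp
  rw [e, div_le_one hu]
  linarith

theorem log_prod_inv_one_sub_exp_le (N : ℕ) {t : ℝ} (ht : 0 < t) :
    log (∏ i ∈ Finset.range N, (1 - exp (-t) ^ (i + 1))⁻¹) ≤ π ^ 2 / 6 / t := by
  have hz := ((hasSum_nat_add_iff' 1).2 hasSum_zeta_two).div_const t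
  simp only [Finset.range_one, Finset.sum_singleton, Nat.cast_zero, ne_eq, OfNat.ofNat_ne_zero,
    not_false_eq_true, zero_pow, div_zero, sub_zero] at hz
  refine hasSum_le (fun k => ?_)
    (log_prod_inv_one_sub_pow_hasSum N (exp_pos (-t)) (exp_lt_one_iff.2 (by linarith))) hz
  have hk : (0 : ℝ) < k + 1 := by positivity
  have e : exp (-t) ^ (k + 1) = exp (-((k + 1) * t)) := by
    rw [← exp_nat_mul]; congr 1; push_cast; ring
  have hle : ∑ i ∈ Finset.range N, (exp (-t) ^ (k + 1)) ^ (i + 1) ≤ ((k + 1) * t)⁻¹ := by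
    rw [e]
    exact (sum_le_hasSum _ (fun i _ => by positivity)
      (hasSum_exp_neg_pow_succ (mul_pos hk ht))).trans (inv_exp_sub_one_le (mul_pos hk ht))
  refine (div_le_div_of_nonneg_right hle hk.le).trans_eq ?_
  push_cast
  field_simp

theorem sum_card_partition_mul_exp_le (s : Finset ℕ) {t : ℝ} (ht : 0 < t) :
    ∑ n ∈ s, (Fintype.card (Nat.Partition n) : ℝ) * exp (-t * n) ≤ exp (π ^ 2 / 6 / t) := by
  obtain ⟨N, hN⟩ := s.exists_le
  have h1 : exp (-t) < 1 := exp_lt_one_iff.2 (by linarith)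
  have h := hasSum_card_restricted_le_mul_pow N (exp_nonneg (-t)) h1
  have hpos : 0 < ∏ i ∈ Finset.range N, (1 - exp (-t) ^ (i + 1))⁻¹ :=
    Finset.prod_pos fun i _ =>
      inv_pos.2 (sub_pos.2 (pow_lt_one₀ (exp_nonneg _) h1 i.succ_ne_zero))
  refine le_trans ?_ ((log_le_iff_le_exp hpos).1 (log_prod_inv_one_sub_exp_le N ht))
  refine le_trans (Finset.sum_le_sum fun n hn => ?_)
    (sum_le_hasSum s (fun n _ => by positivity) h)
  rw [card_restricted_le_eq_card (hN n hn), ← exp_nat_mul, mul_comm (n : ℝ)]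

theorem summable_card_partition_mul_exp {t : ℝ} (ht : 0 < t) :
    Summable fun n : ℕ => (Fintype.card (Nat.Partition n) : ℝ) * exp (-t * n) :=
  summable_of_sum_le (fun n => by positivity) fun s => sum_card_partition_mul_exp_le s ht

theorem prod_inv_one_sub_exp_le_tsum_card_partition (N : ℕ) {t : ℝ} (ht : 0 < t) :
    ∏ i ∈ Finset.range N, (1 - exp (-t) ^ (i + 1))⁻¹ ≤
      ∑' n : ℕ, (Fintype.card (Nat.Partition n) : ℝ) * exp (-t * n) := by
  refine hasSum_le (fun n => ?_) (hasSum_card_restricted_le_mul_pow N (exp_nonneg (-t))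
    (exp_lt_one_iff.2 (by linarith))) (summable_card_partition_mul_exp ht).hasSum
  rw [← exp_nat_mul, mul_comm (n : ℝ)]
  gcongr
  exact Finset.card_le_univ _

theorem sum_le_mul_log_tsum_card_partition (K : ℕ) {t : ℝ} (ht : 0 < t) :
    ∑ k ∈ Finset.range K, (1 / ((k + 1 : ℕ) : ℝ) ^ 2 - t / (k + 1)) ≤
      t * log (∑' n : ℕ, (Fintype.card (Nat.Partition n) : ℝ) * exp (-t * n)) := by
  have h1 : exp (-t) < 1 := exp_lt_one_iff.2 (by linarith)
  have e : ∀ k : ℕ, exp (-t) ^ (k + 1) = exp (-((k + 1) * t)) := fun k => by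
    rw [← exp_nat_mul]; congr 1; push_cast; ring
  have hN : ∀ N : ℕ, ∑ k ∈ Finset.range K,
      (∑ i ∈ Finset.range N, (exp (-t) ^ (k + 1)) ^ (i + 1)) / ((k : ℝ) + 1) ≤
      log (∑' n : ℕ, (Fintype.card (Nat.Partition n) : ℝ) * exp (-t * n)) := fun N =>
    (sum_le_hasSum _ (fun k _ => by positivity)
      (log_prod_inv_one_sub_pow_hasSum N (exp_pos (-t)) h1)).trans
      (log_le_log (Finset.prod_pos fun i _ =>
        inv_pos.2 (sub_pos.2 (pow_lt_one₀ (exp_nonneg _) h1 i.succ_ne_zero)))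
        (prod_inv_one_sub_exp_le_tsum_card_partition N ht))
  have hlim : Tendsto (fun N : ℕ => ∑ k ∈ Finset.range K,
      (∑ i ∈ Finset.range N, (exp (-t) ^ (k + 1)) ^ (i + 1)) / ((k : ℝ) + 1)) atTop
      (nhds (∑ k ∈ Finset.range K, (exp ((k + 1) * t) - 1)⁻¹ / ((k : ℝ) + 1))) := by
    refine tendsto_finsetSum _ fun k _ => ?_
    rw [e]
    exact (hasSum_exp_neg_pow_succ (by positivity)).tendsto_sum_nat.div_const _
  refine le_trans ?_ (mul_le_mul_of_nonneg_left (le_of_tendsto' hlim hN) ht.le)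
  rw [Finset.mul_sum]
  refine Finset.sum_le_sum fun k _ => ?_
  have hk : (0 : ℝ) < k + 1 := by positivity
  refine le_trans (le_of_eq ?_) (mul_le_mul_of_nonneg_left (div_le_div_of_nonneg_right
    (inv_sub_one_le_inv_exp_sub_one (mul_pos hk ht)) hk.le) ht.le)
  push_cast
  field_simp

theorem tendsto_mul_log_tsum_card_partition :
    Tendsto (fun t : ℝ => t * log (∑' n : ℕ, (Fintype.card (Nat.Partition n) : ℝ) *
      exp (-t * n))) (nhdsWithin 0 (Set.Ioi 0)) (nhds (π ^ 2 / 6)) := by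
  refine tendsto_order.2 ⟨fun b hb => ?_, fun b hb => ?_⟩
  · have hz := ((hasSum_nat_add_iff' 1).2 hasSum_zeta_two).tendsto_sum_nat
    simp only [Finset.range_one, Finset.sum_singleton, Nat.cast_zero, ne_eq,
      OfNat.ofNat_ne_zero, not_false_eq_true, zero_pow, div_zero, sub_zero] at hz
    obtain ⟨K, hK⟩ := (hz.eventually_const_lt hb).exists
    have hcont : Continuous fun t : ℝ =>
        ∑ k ∈ Finset.range K, (1 / ((k + 1 : ℕ) : ℝ) ^ 2 - t / (k + 1)) := by fun_prop
    have h0 := (hcont.tendsto 0).mono_left (nhdsWithin_le_nhds (s := Set.Ioi 0))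
    simp only [zero_div, sub_zero] at h0
    filter_upwards [h0.eventually_const_lt hK, self_mem_nhdsWithin] with t hlt ht
    exact hlt.trans_le (sum_le_mul_log_tsum_card_partition K ht)
  · filter_upwards [self_mem_nhdsWithin] with t ht
    have ht : 0 < t := ht
    refine lt_of_le_of_lt ?_ hb
    have hs := summable_card_partition_mul_exp ht
    have hle := hs.tsum_le_of_sum_le fun s => sum_card_partition_mul_exp_le s ht
    have hpos : 0 < ∑' n : ℕ, (Fintype.card (Nat.Partition n) : ℝ) * exp (-t * n) :=
      hs.tsum_pos (fun n => by positivity) 0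
        (mul_pos (Nat.cast_pos.2 Fintype.card_pos) (exp_pos _))
    rw [← le_div_iff₀' ht]
    exact (log_le_iff_le_exp hpos).2 hle

theorem two_mul_sqrt_pi_sq_div_six : 2 * √(π ^ 2 / 6) = π * √(2 / 3) := by
  rw [show (2 / 3 : ℝ) = 2 ^ 2 * (1 / 6) by norm_num, sqrt_mul (by norm_num),
    sqrt_sq (by norm_num), show π ^ 2 / 6 = π ^ 2 * (1 / 6) by ring,
    sqrt_mul (by positivity), sqrt_sq pi_pos.le]
  ring

theorem log_partition_asymptotic :
    Tendsto
      (fun n : ℕ => Real.log (Fintype.card (Nat.Partition n)) / Real.sqrt n)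
      atTop (nhds (π * Real.sqrt (2 / 3))) := by
  rw [← two_mul_sqrt_pi_sq_div_six]
  exact tendsto_log_div_sqrt_of_laplace (a := fun n => (Fintype.card (Nat.Partition n) : ℝ))
    (by positivity) (fun m n h => Nat.cast_le.2 (monotone_card_partition h))
    (fun n => Nat.cast_pos.2 Fintype.card_pos) (fun t ht => summable_card_partition_mul_exp ht)
    tendsto_mul_log_tsum_card_partition
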